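/- Let K be a nonempty ℍ-hull. Then for every x ∈ ℝ \ K^doub, 0 < g_K'(x) ≤ 1. Moreover g_K' is decreasing on (-∞, a_K) and increasing on (b_K, ∞). -/

import Mathlib

open Complex Filter Set Metric Bornology Topology

noncomputable section

/-- The open upper half-plane `ℍ`. -/
def UHP : Set ℂ := {z : ℂ | 0 < z.im}

/-- `K^doub`: the closure of `K` together with its reflection across `ℝ`. -/
def Kdoub (K : Set ℂ) : Set ℂ := closure K ∪ (starRingEnd ℂ) '' closure K

/-- `a_K = min (cl K ∩ ℝ)`. -/
def aK (K : Set ℂ) : ℝ := sInf {x : ℝ | (x : ℂ) ∈ closure K}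

/-- `b_K = max (cl K ∩ ℝ)`. -/
def bK (K : Set ℂ) : ℝ := sSup {x : ℝ | (x : ℂ) ∈ closure K}

/-- The segment `[a_K, b_K]` regarded as a subset of `ℂ`. -/
def seg (K : Set ℂ) : Set ℂ := (fun t : ℝ => (t : ℂ)) '' Set.Icc (aK K) (bK K)

/-- `K` is an `ℍ`-hull with mapping-out function `g` (normalized hydrodynamically at `∞`),
whose Schwarz reflection maps the complement of `K^doub ∪ [a_K, b_K]` onto `ℂ \ S_K`
for the compact set `S = S_K ⊆ ℝ`. -/
structure IsHullMap (K : Set ℂ) (g : ℂ → ℂ) (S : Set ℝ) : Prop where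
  subset_UHP : K ⊆ UHP
  bounded : IsBounded K
  relClosed : ∀ z ∈ closure K, 0 < z.im → z ∈ K
  holo : DifferentiableOn ℂ g (UHP \ K)
  bij : Set.BijOn g (UHP \ K) UHP
  hydro : Tendsto (fun z => g z - z) (Bornology.cobounded ℂ) (nhds 0)
  compactS : IsCompact S
  ext_holo : K.Nonempty → DifferentiableOn ℂ g {z : ℂ | z ∉ Kdoub K}
  real_vals : K.Nonempty → ∀ x : ℝ, (x : ℂ) ∉ Kdoub K → (g (x : ℂ)).im = 0
  conj_symm : K.Nonempty → ∀ z : ℂ, z ∉ Kdoub K → g ((starRingEnd ℂ) z) = (starRingEnd ℂ) (g z)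
  extBij : K.Nonempty →
    Set.BijOn g {z : ℂ | z ∉ Kdoub K ∧ z ∉ seg K} {z : ℂ | ∀ s ∈ S, z ≠ (s : ℂ)}

/-- `g` has half-plane capacity `c` : `g z = z + c / z + O(1/z²)` near `∞`. -/
def HasHcap (g : ℂ → ℂ) (c : ℝ) : Prop :=
  Tendsto (fun z : ℂ => z * (g z - z)) (Bornology.cobounded ℂ) (nhds (c : ℂ))

/-! ### Inverses of injective holomorphic functions -/

lemma nhds_le_map_nhds_of_injOn {g : ℂ → ℂ} {D : Set ℂ} (hD : IsOpen D)
    (hg : DifferentiableOn ℂ g D) (hinj : InjOn g D) {z : ℂ} (hz : z ∈ D) :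
    𝓝 (g z) ≤ map g (𝓝 z) := by
  refine (hg.analyticAt (hD.mem_nhds hz)).eventually_constant_or_nhds_le_map_nhds.resolve_left ?_
  intro hc
  have h1 : ∀ᶠ y in 𝓝 z, y = z := by
    filter_upwards [hc, hD.mem_nhds hz] with y hy hyD using hinj hyD hz hy
  have h2 : ∀ᶠ y in 𝓝[≠] z, y = z := h1.filter_mono nhdsWithin_le_nhds
  obtain ⟨y, hy, hy'⟩ := (h2.and self_mem_nhdsWithin).exists
  exact hy' hy

lemma continuousAt_of_leftInvOn {f g : ℂ → ℂ} {D : Set ℂ} (hD : IsOpen D)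
    (hg : DifferentiableOn ℂ g D) (hfg : LeftInvOn f g D) {z : ℂ} (hz : z ∈ D) :
    ContinuousAt f (g z) := by
  rw [ContinuousAt, hfg hz]
  calc map f (𝓝 (g z)) ≤ map f (map g (𝓝 z)) :=
        map_mono (nhds_le_map_nhds_of_injOn hD hg hfg.injOn hz)
    _ = map (f ∘ g) (𝓝 z) := map_map
    _ = map id (𝓝 z) := map_congr (by
        filter_upwards [hD.mem_nhds hz] with y hy using hfg hy)
    _ ≤ 𝓝 z := by simp

lemma image_mem_nhds_of_injOn {g : ℂ → ℂ} {D : Set ℂ} (hD : IsOpen D)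
    (hg : DifferentiableOn ℂ g D) (hinj : InjOn g D) {z : ℂ} (hz : z ∈ D) :
    g '' D ∈ 𝓝 (g z) :=
  nhds_le_map_nhds_of_injOn hD hg hinj hz (image_mem_map (hD.mem_nhds hz))

lemma eventually_deriv_ne_zero_of_injOn {g : ℂ → ℂ} {D : Set ℂ} (hD : IsOpen D)
    (hg : DifferentiableOn ℂ g D) (hinj : InjOn g D) {z : ℂ} (hz : z ∈ D) :
    ∀ᶠ y in 𝓝[≠] z, deriv g y ≠ 0 := by
  refine (hg.analyticAt (hD.mem_nhds hz)).deriv.eventually_eq_zero_or_eventually_ne_zero.resolve_left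
    fun h0 => ?_
  obtain ⟨r, hr, hball⟩ := Metric.eventually_nhds_iff_ball.1 (h0.and (hD.mem_nhds hz))
  have hmem : z + (r / 2 : ℝ) ∈ ball z r := by
    simp [abs_of_pos hr, hr]
  have heq : g (z + (r / 2 : ℝ)) = g z :=
    isOpen_ball.is_const_of_deriv_eq_zero (convex_ball z r).isPreconnected
      (hg.mono fun y hy => (hball y hy).2) (fun y hy => (hball y hy).1) hmem (mem_ball_self hr)
  have := hinj (hball _ hmem).2 hz heq
  simp [hr.ne'] at this

lemma hasDerivAt_of_leftInvOn {f g : ℂ → ℂ} {D : Set ℂ} (hD : IsOpen D)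
    (hg : DifferentiableOn ℂ g D) (hfg : LeftInvOn f g D) {z : ℂ} (hz : z ∈ D)
    (h0 : deriv g z ≠ 0) : HasDerivAt f (deriv g z)⁻¹ (g z) := by
  refine HasDerivAt.of_local_left_inverse (f := g) (continuousAt_of_leftInvOn hD hg hfg hz) ?_ h0 ?_
  · rw [hfg hz]
    exact (hg.differentiableAt (hD.mem_nhds hz)).hasDerivAt
  · filter_upwards [image_mem_nhds_of_injOn hD hg hfg.injOn hz]
    rintro _ ⟨y, hy, rfl⟩
    rw [hfg hy]

lemma differentiableAt_of_leftInvOn {f g : ℂ → ℂ} {D : Set ℂ} (hD : IsOpen D)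
    (hg : DifferentiableOn ℂ g D) (hfg : LeftInvOn f g D) {z : ℂ} (hz : z ∈ D) :
    DifferentiableAt ℂ f (g z) := by
  have hc := continuousAt_of_leftInvOn hD hg hfg hz
  refine (analyticAt_of_differentiable_on_punctured_nhds_of_continuousAt ?_ hc).differentiableAt
  have h1 := eventually_nhdsWithin_iff.1 (eventually_deriv_ne_zero_of_injOn hD hg hfg.injOn hz)
  rw [ContinuousAt, hfg hz] at hc
  rw [eventually_nhdsWithin_iff]
  filter_upwards [hc.eventually h1, image_mem_nhds_of_injOn hD hg hfg.injOn hz] with w hw hwD hne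
  obtain ⟨y, hy, rfl⟩ := hwD
  rw [hfg hy] at hw
  refine (hasDerivAt_of_leftInvOn hD hg hfg hy (hw ?_)).differentiableAt
  rintro rfl
  exact hne rfl

lemma deriv_ne_zero_of_injOn {g : ℂ → ℂ} {D : Set ℂ} (hD : IsOpen D)
    (hg : DifferentiableOn ℂ g D) (hinj : InjOn g D) {z : ℂ} (hz : z ∈ D) : deriv g z ≠ 0 := by
  have hfg := hinj.leftInvOn_invFunOn
  have h1 := (differentiableAt_of_leftInvOn hD hg hfg hz).hasDerivAt.comp z
    (hg.differentiableAt (hD.mem_nhds hz)).hasDerivAt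
  have h2 : HasDerivAt (Function.invFunOn g D ∘ g) 1 z :=
    (hasDerivAt_id z).congr_of_eventuallyEq
      (by filter_upwards [hD.mem_nhds hz] with y hy using hfg hy)
  exact right_ne_zero_of_mul_eq_one (h1.unique h2)

/-! ### Boundary derivatives -/

lemma HasDerivAt.im_eq_zero_of_real {F : ℂ → ℂ} {F' : ℂ} {x : ℝ} (hF : HasDerivAt F F' x)
    (hreal : ∀ᶠ t : ℝ in 𝓝 x, (F t).im = 0) : F'.im = 0 := by
  have h1 := (hF.const_mul (-I)).real_of_complex
  have h2 : HasDerivAt (fun t : ℝ => (-I * F t).re) 0 x :=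
    (hasDerivAt_const x (0 : ℝ)).congr_of_eventuallyEq (by
      filter_upwards [hreal] with t ht
      simp [ht])
  simpa using h1.unique h2

lemma HasDerivAt.re_nonneg_of_im_nonneg {F : ℂ → ℂ} {F' : ℂ} {x : ℝ} (hF : HasDerivAt F F' x)
    (hx : (F x).im = 0) (hpos : ∀ᶠ w in 𝓝 (x : ℂ), 0 < w.im → 0 ≤ (F w).im) : 0 ≤ F'.re := by
  have hl : HasDerivAt (fun z : ℂ => (x : ℂ) + z * I) I ((0 : ℝ) : ℂ) := by
    simpa using ((hasDerivAt_id ((0 : ℝ) : ℂ)).mul_const I).const_add (x : ℂ)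
  have h1 : HasDerivAt (fun z : ℂ => F (x + z * I)) (F' * I) ((0 : ℝ) : ℂ) := by
    refine HasDerivAt.comp (h₂ := F) ((0 : ℝ) : ℂ) ?_ hl
    simpa using hF
  have h2 : HasDerivAt (fun t : ℝ => (F (x + t * I)).im) F'.re 0 := by
    simpa using (h1.const_mul (-I)).real_of_complex
  have hc : Tendsto (fun t : ℝ => (x : ℂ) + t * I) (𝓝[>] 0) (𝓝 (x : ℂ)) := by
    have : Continuous fun t : ℝ => (x : ℂ) + t * I := by fun_prop
    simpa using (this.tendsto 0).mono_left nhdsWithin_le_nhds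
  refine ge_of_tendsto h2.tendsto_slope_zero_right ?_
  filter_upwards [hc.eventually hpos, self_mem_nhdsWithin] with t ht ht0
  have ht0' : 0 < t := ht0
  have := ht (by simpa using ht0')
  simp only [zero_add, ofReal_zero, zero_mul, add_zero, hx, sub_zero, smul_eq_mul]
  positivity

/-! ### A minimum principle on the half-plane -/

lemma isOpen_UHP : IsOpen UHP := isOpen_lt continuous_const continuous_im

lemma isPreconnected_UHP : IsPreconnected UHP := (convex_halfSpace_im_gt 0).isPreconnected

lemma im_nonneg_of_boundary {F : ℂ → ℂ} (hF : DifferentiableOn ℂ F UHP)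
    (hbdry : ∀ p : ℝ, ∀ ε > 0, ∀ᶠ w in 𝓝 (p : ℂ), 0 < w.im → -ε ≤ (F w).im)
    (hinf : ∀ ε > 0, ∀ᶠ w in cobounded ℂ, 0 < w.im → -ε ≤ (F w).im) {w : ℂ} (hw : 0 < w.im) :
    0 ≤ (F w).im := by
  by_contra! hneg
  set ε := -(F w).im with hε
  have hε0 : 0 < ε := by linarith
  set A : Set ℂ := {z | 0 < z.im ∧ (F z).im ≤ -ε} with hA
  have hwA : w ∈ A := ⟨hw, by linarith⟩
  have hAb : IsBounded A := by
    rw [isBounded_def]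
    filter_upwards [hinf (ε / 2) (by linarith)] with z hz hzA
    linarith [hz hzA.1, hzA.2]
  have hAc : IsClosed A := by
    rw [← closure_subset_iff_isClosed]
    intro p hp
    have hfr : ∃ᶠ z in 𝓝 p, z ∈ A := mem_closure_iff_frequently.1 hp
    have hp0 : 0 ≤ p.im :=
      closure_minimal (fun z hz => hz.1.le) (isClosed_le continuous_const continuous_im) hp
    rcases hp0.eq_or_lt with h0 | h0
    · exfalso
      have hpe : p = (p.re : ℂ) := Complex.ext (by simp) (by simp [← h0])
      rw [hpe] at hfr
      obtain ⟨z, hzA, hz⟩ := (hfr.and_eventually (hbdry p.re (ε / 2) (by linarith))).exists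
      linarith [hz hzA.1, hzA.2]
    · refine ⟨h0, ?_⟩
      have hcont : ContinuousAt (fun z => (F z).im) p :=
        continuous_im.continuousAt.comp (hF.continuousOn.continuousAt (isOpen_UHP.mem_nhds h0))
      by_contra! hlt
      obtain ⟨z, hzA, hz⟩ := (hfr.and_eventually (hcont.eventually (lt_mem_nhds hlt))).exists
      linarith [hzA.2]
  have hsub : A ⊆ UHP := fun z hz => hz.1
  obtain ⟨m, hmA, hm⟩ := (isCompact_of_isClosed_isBounded hAc hAb).exists_isMinOn ⟨w, hwA⟩
    (f := fun z => (F z).im) (continuous_im.comp_continuousOn (hF.continuousOn.mono hsub))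
  have hmin : ∀ z ∈ UHP, (F m).im ≤ (F z).im := fun z hz => by
    by_cases hzA : z ∈ A
    · exact hm hzA
    · have : -ε < (F z).im := by
        by_contra! hle
        exact hzA ⟨hz, hle⟩
      linarith [hmA.2]
  have hconst := norm_eqOn_of_isPreconnected_of_isMaxOn (f := fun z => exp (I * F z))
    isPreconnected_UHP isOpen_UHP (hF.const_mul I).cexp (hsub hmA) (by
      intro z hz
      simpa [Complex.norm_exp] using hmin z hz)
  have hUA : UHP ⊆ A := fun z hz => by
    have := hconst hz
    simp only [Function.comp, Complex.norm_exp, Function.const, Real.exp_eq_exp] at this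
    have h2 : (F z).im = (F m).im := by simpa using this
    exact ⟨hz, h2 ▸ hmA.2⟩
  obtain ⟨C, hC⟩ := hAb.exists_norm_le
  have h1 : ((|C| + 1 : ℝ) : ℂ) * I ∈ UHP := by
    simp only [UHP, mem_ofPred_eq, im_ofReal_mul, I_im, mul_one]
    positivity
  have h2 := hC _ (hUA h1)
  rw [norm_mul, norm_I, mul_one, norm_real, Real.norm_eq_abs, abs_of_pos (by positivity)] at h2
  linarith [le_abs_self C]

/-! ### Bounded Pick functions -/

/-- A bounded holomorphic function on `ℂ \ S`, where `S ⊆ ℝ` is compact, which is real on `ℝ \ S`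
and maps the open upper (lower) half-plane to the closed upper (lower) half-plane. -/
structure IsBoundedPick (φ : ℂ → ℂ) (S : Set ℝ) : Prop where
  isCompact : IsCompact S
  differentiableOn : DifferentiableOn ℂ φ {z : ℂ | ∀ s ∈ S, z ≠ (s : ℂ)}
  real : ∀ x : ℝ, x ∉ S → (φ x).im = 0
  im_nonneg : ∀ w : ℂ, 0 < w.im → 0 ≤ (φ w).im
  im_nonpos : ∀ w : ℂ, w.im < 0 → (φ w).im ≤ 0
  bounded : ∃ M : ℝ, ∀ w : ℂ, (∀ s ∈ S, w ≠ (s : ℂ)) → ‖φ w‖ ≤ M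

lemma IsCompact.isOpen_compl_ofReal {S : Set ℝ} (hS : IsCompact S) :
    IsOpen {z : ℂ | ∀ s ∈ S, z ≠ (s : ℂ)} := by
  have h : {z : ℂ | ∀ s ∈ S, z ≠ (s : ℂ)} = ((fun t : ℝ => (t : ℂ)) '' S)ᶜ := by
    ext z
    simp [eq_comm]
  rw [h]
  exact (hS.image continuous_ofReal).isClosed.isOpen_compl

lemma ofReal_forall_ne {S : Set ℝ} {x : ℝ} (hx : x ∉ S) : ∀ s ∈ S, (x : ℂ) ≠ s := by
  rintro s hs h
  exact hx (ofReal_injective h ▸ hs)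

lemma forall_ne_of_im_ne_zero {S : Set ℝ} {w : ℂ} (hw : w.im ≠ 0) : ∀ s ∈ S, w ≠ (s : ℂ) := by
  rintro s _ rfl
  simp at hw

namespace IsBoundedPick

variable {φ : ℂ → ℂ} {S : Set ℝ}

lemma differentiableAt (h : IsBoundedPick φ S) {x : ℝ} (hx : x ∉ S) :
    DifferentiableAt ℂ φ x :=
  h.differentiableOn.differentiableAt (h.isCompact.isOpen_compl_ofReal.mem_nhds (ofReal_forall_ne hx))

lemma eventually_notMem (h : IsBoundedPick φ S) {x : ℝ} (hx : x ∉ S) : ∀ᶠ t in 𝓝 x, t ∉ S :=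
  h.isCompact.isClosed.isOpen_compl.mem_nhds hx

lemma deriv_im (h : IsBoundedPick φ S) {x : ℝ} (hx : x ∉ S) : (deriv φ x).im = 0 := by
  refine (h.differentiableAt hx).hasDerivAt.im_eq_zero_of_real ?_
  filter_upwards [h.eventually_notMem hx] with t ht using h.real t ht

lemma differentiableOn_dslope (h : IsBoundedPick φ S) {q : ℝ} (hq : q ∉ S) :
    DifferentiableOn ℂ (dslope φ q) {z : ℂ | ∀ s ∈ S, z ≠ (s : ℂ)} :=
  (Complex.differentiableOn_dslope
    (h.isCompact.isOpen_compl_ofReal.mem_nhds (ofReal_forall_ne hq))).2 h.differentiableOn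

lemma dslope_real (h : IsBoundedPick φ S) {q : ℝ} (hq : q ∉ S) {x : ℝ} (hx : x ∉ S) :
    (dslope φ q x).im = 0 := by
  rcases eq_or_ne x q with rfl | hne
  · rw [dslope_same]
    exact h.deriv_im hq
  · rw [dslope_of_ne _ (by exact_mod_cast hne), slope_def_field, ← ofReal_sub, div_ofReal_im, sub_im,
      h.real x hx, h.real q hq]
    simp

lemma im_dslope_nonpos (h : IsBoundedPick φ S) {q : ℝ} (hq : ∀ s ∈ S, s < q) {w : ℂ}
    (hw : 0 < w.im) : (dslope φ q w).im ≤ 0 := by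
  have hqS : q ∉ S := fun hqS => lt_irrefl q (hq q hqS)
  obtain ⟨M, hM⟩ := h.bounded
  have hM0 : 0 ≤ M := (norm_nonneg _).trans (hM q (ofReal_forall_ne hqS))
  have hbd : ∀ z : ℂ, 0 < z.im → ‖φ z - φ q‖ ≤ 2 * M := fun z hz => by
    linarith [norm_sub_le (φ z) (φ q), hM z (forall_ne_of_im_ne_zero hz.ne'),
      hM q (ofReal_forall_ne hqS)]
  have hslope : ∀ z : ℂ, 0 < z.im → dslope φ q z = (φ z - φ q) * (z - q)⁻¹ := fun z hz => by
    rw [dslope_of_ne, slope_def_field, div_eq_mul_inv]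
    rintro rfl
    simp at hz
  have key : 0 ≤ (-dslope φ q w).im := by
    refine im_nonneg_of_boundary (F := fun z => -dslope φ q z)
      ((h.differentiableOn_dslope hqS).neg.mono fun z hz =>
        forall_ne_of_im_ne_zero (ne_of_gt hz)) ?_ ?_ hw
    · intro p ε hε
      by_cases hp : p ∈ S
      · have hpq : p < q := hq p hp
        have hc : ContinuousAt (fun z : ℂ => (z - q)⁻¹) (p : ℂ) := by
          refine ContinuousAt.inv₀ (by fun_prop) ?_
          rw [← ofReal_sub]
          exact_mod_cast (sub_neg.2 hpq).ne
        have hre : ∀ᶠ z : ℂ in 𝓝 (p : ℂ), ((z - q)⁻¹).re < 0 := by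
          refine (continuous_re.continuousAt.comp hc).eventually (gt_mem_nhds ?_)
          simp only [Function.comp, ← ofReal_sub, ← ofReal_inv, ofReal_re]
          exact inv_lt_zero.2 (sub_neg.2 hpq)
        have him : ∀ᶠ z : ℂ in 𝓝 (p : ℂ), |((z - q)⁻¹).im| < ε / (2 * M + 1) := by
          refine (continuous_abs.continuousAt.comp
            (continuous_im.continuousAt.comp hc)).eventually (gt_mem_nhds ?_)
          simp only [Function.comp, ← ofReal_sub, ← ofReal_inv, ofReal_im, abs_zero]
          positivity
        filter_upwards [hre, him] with z hz1 hz2 hz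
        rw [hslope z hz, neg_im, mul_im, sub_im, h.real q hqS, sub_zero]
        have h1 : |(φ z - φ q).re * ((z - q)⁻¹).im| ≤ ε := by
          rw [abs_mul]
          calc |(φ z - φ q).re| * |((z - q)⁻¹).im| ≤ (2 * M + 1) * (ε / (2 * M + 1)) := by
                gcongr
                linarith [abs_re_le_norm (φ z - φ q), hbd z hz]
            _ = ε := by field_simp
        have h2 := mul_nonpos_of_nonneg_of_nonpos (h.im_nonneg z hz) hz1.le
        linarith [(abs_le.1 h1).2]
      · have hc : ContinuousAt (fun z : ℂ => (-dslope φ q z).im) (p : ℂ) :=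
          continuous_im.continuousAt.comp ((h.differentiableOn_dslope hqS).continuousOn.continuousAt
            (h.isCompact.isOpen_compl_ofReal.mem_nhds (ofReal_forall_ne hp))).neg
        have h0 : -ε < (-dslope φ q p).im := by
          rw [neg_im, h.dslope_real hqS hp]
          linarith
        filter_upwards [hc.eventually (lt_mem_nhds h0)] with z hz _ using hz.le
    · intro ε hε
      have ht : Tendsto (fun z : ℂ => (z - q)⁻¹) (cobounded ℂ) (𝓝 0) :=
        tendsto_inv₀_cobounded.comp (tendsto_sub_const_cobounded (q : ℂ))
      have ht' := ht.norm
      rw [norm_zero] at ht'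
      have hpos : 0 < ε / (2 * M + 1) := by positivity
      filter_upwards [ht'.eventually (gt_mem_nhds hpos)] with z hz1 hz
      have h1 : ‖dslope φ q z‖ ≤ ε := by
        rw [hslope z hz, norm_mul]
        calc ‖φ z - φ q‖ * ‖(z - q)⁻¹‖ ≤ (2 * M + 1) * (ε / (2 * M + 1)) := by
              gcongr
              linarith [hbd z hz]
          _ = ε := by field_simp
      rw [neg_im]
      linarith [abs_le.1 ((abs_im_le_norm _).trans h1)]
  rw [neg_im] at key
  linarith

lemma re_dslope_antitone (h : IsBoundedPick φ S) {q : ℝ} (hq : ∀ s ∈ S, s < q) {x y : ℝ}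
    (hx : ∀ s ∈ S, s < x) (hxy : x ≤ y) : (dslope φ q y).re ≤ (dslope φ q x).re := by
  have hqS : q ∉ S := fun hqS => lt_irrefl q (hq q hqS)
  have hS : ∀ t ∈ Icc x y, t ∉ S := fun t ht hts => (hx t hts).not_ge ht.1
  have hd : ∀ t ∈ Icc x y, HasDerivAt (dslope φ q) (deriv (dslope φ q) t) (t : ℂ) := fun t ht =>
    ((h.differentiableOn_dslope hqS).differentiableAt
      (h.isCompact.isOpen_compl_ofReal.mem_nhds (ofReal_forall_ne (hS t ht)))).hasDerivAt
  refine antitoneOn_of_deriv_nonpos (f := fun t : ℝ => (dslope φ q t).re) (convex_Icc x y)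
    (fun t ht => (hd t ht).real_of_complex.continuousAt.continuousWithinAt)
    (fun t ht => (hd t (interior_subset ht)).real_of_complex.differentiableAt.differentiableWithinAt)
    (fun t ht => ?_) (left_mem_Icc.2 hxy) (right_mem_Icc.2 hxy) hxy
  have ht' := interior_subset ht
  rw [(hd t ht').real_of_complex.deriv]
  have := (hd t ht').neg.re_nonneg_of_im_nonneg
    (by simp [h.dslope_real hqS (hS t ht')])
    (Eventually.of_forall fun w hw => by simpa using h.im_dslope_nonpos hq hw)
  simpa using this

lemma deriv_antitone_right (h : IsBoundedPick φ S) {x y : ℝ} (hx : ∀ s ∈ S, s < x)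
    (hxy : x ≤ y) : (deriv φ y).re ≤ (deriv φ x).re := by
  have hy : ∀ s ∈ S, s < y := fun s hs => (hx s hs).trans_le hxy
  rcases hxy.eq_or_lt with rfl | hlt
  · rfl
  have h1 := h.re_dslope_antitone hx hx hxy
  have h2 := h.re_dslope_antitone hy hx hxy
  have hne : (x : ℂ) ≠ y := by exact_mod_cast hlt.ne
  rw [dslope_same] at h1 h2
  rw [dslope_of_ne _ hne.symm, slope_comm] at h1
  rw [dslope_of_ne _ hne] at h2
  linarith

lemma reflect (h : IsBoundedPick φ S) : IsBoundedPick (fun w => -φ (-w)) (Neg.neg '' S) where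
  isCompact := h.isCompact.image continuous_neg
  differentiableOn := by
    refine (h.differentiableOn.comp differentiable_neg.differentiableOn fun z hz s hs hzs => ?_).neg
    exact hz (-s) (mem_image_of_mem _ hs) (by rw [ofReal_neg, ← hzs, neg_neg])
  real x hx := by
    have := h.real (-x) fun hs => hx ⟨-x, hs, neg_neg x⟩
    simpa using this
  im_nonneg w hw := by simpa using h.im_nonpos (-w) (by simpa using hw)
  im_nonpos w hw := by simpa using h.im_nonneg (-w) (by simpa using hw)
  bounded := by
    obtain ⟨M, hM⟩ := h.bounded
    refine ⟨M, fun w hw => ?_⟩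
    rw [norm_neg]
    exact hM _ fun s hs hws => hw (-s) (mem_image_of_mem _ hs) (by rw [ofReal_neg, ← hws, neg_neg])

lemma deriv_monotone_left (h : IsBoundedPick φ S) {x y : ℝ} (hy : ∀ s ∈ S, y < s)
    (hxy : x ≤ y) : (deriv φ x).re ≤ (deriv φ y).re := by
  have hd : ∀ t : ℝ, deriv (fun w => -φ (-w)) ((-t : ℝ) : ℂ) = deriv φ t := fun t => by
    rw [deriv.fun_neg, deriv_comp_neg]
    simp
  have := h.reflect.deriv_antitone_right (x := -y) (y := -x)
    (by rintro _ ⟨s, hs, rfl⟩; exact neg_lt_neg (hy s hs)) (neg_le_neg hxy)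
  rwa [hd, hd] at this

end IsBoundedPick

/-! ### The mapping-out function and its inverse -/

lemma isClosed_Kdoub (K : Set ℂ) : IsClosed (Kdoub K) :=
  isClosed_closure.union (conjCLE.toHomeomorph.isClosedMap _ isClosed_closure)

lemma eventually_notMem_Kdoub {K : Set ℂ} {z : ℂ} (hz : z ∉ Kdoub K) : ∀ᶠ w in 𝓝 z, w ∉ Kdoub K :=
  (isClosed_Kdoub K).isOpen_compl.mem_nhds hz

lemma conj_mem_Kdoub {K : Set ℂ} {z : ℂ} (hz : starRingEnd ℂ z ∈ Kdoub K) : z ∈ Kdoub K := by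
  rcases hz with hz | ⟨y, hy, hyz⟩
  · exact Or.inr ⟨_, hz, conj_conj z⟩
  · exact Or.inl ((starRingEnd ℂ).injective hyz ▸ hy)

lemma conj_mem_seg {K : Set ℂ} {z : ℂ} (hz : starRingEnd ℂ z ∈ seg K) : z ∈ seg K := by
  obtain ⟨t, ht, htz⟩ := hz
  refine ⟨t, ht, (starRingEnd ℂ).injective ?_⟩
  simpa using htz

lemma isCompact_seg (K : Set ℂ) : IsCompact (seg K) := isCompact_Icc.image continuous_ofReal

lemma ofReal_mem_closure_of_mem_Kdoub {K : Set ℂ} {x : ℝ} (hx : (x : ℂ) ∈ Kdoub K) :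
    (x : ℂ) ∈ closure K := by
  rcases hx with hx | ⟨y, hy, hyx⟩
  · exact hx
  · rwa [← conj_ofReal, ← hyx, conj_conj]

/-- The domain of the Schwarz reflection of the mapping-out function. -/
def extDomain (K : Set ℂ) : Set ℂ := {z : ℂ | z ∉ Kdoub K ∧ z ∉ seg K}

lemma isOpen_extDomain (K : Set ℂ) : IsOpen (extDomain K) :=
  (isClosed_Kdoub K).isOpen_compl.inter (isCompact_seg K).isClosed.isOpen_compl

lemma conj_mem_extDomain {K : Set ℂ} {z : ℂ} (hz : z ∈ extDomain K) :
    starRingEnd ℂ z ∈ extDomain K :=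
  ⟨fun h => hz.1 (conj_mem_Kdoub h), fun h => hz.2 (conj_mem_seg h)⟩

lemma bddAbove_and_bddBelow_of_isBounded {K : Set ℂ} (hK : IsBounded K) :
    BddAbove {x : ℝ | (x : ℂ) ∈ closure K} ∧ BddBelow {x : ℝ | (x : ℂ) ∈ closure K} := by
  obtain ⟨C, hC⟩ := hK.closure.exists_norm_le
  refine ⟨⟨C, fun x hx => ?_⟩, ⟨-C, fun x hx => ?_⟩⟩ <;>
  · have := hC _ hx
    rw [norm_real, Real.norm_eq_abs] at this
    linarith [abs_le.1 this]

lemma ofReal_mem_extDomain_of_gt {K : Set ℂ} (hK : IsBounded K) {x : ℝ} (hx : bK K < x) :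
    (x : ℂ) ∈ extDomain K := by
  refine ⟨fun h => ?_, fun ⟨t, ht, htx⟩ => ?_⟩
  · exact hx.not_ge (le_csSup (bddAbove_and_bddBelow_of_isBounded hK).1
      (ofReal_mem_closure_of_mem_Kdoub h))
  · exact hx.not_ge (ofReal_injective htx ▸ ht.2)

lemma ofReal_mem_extDomain_of_lt {K : Set ℂ} (hK : IsBounded K) {x : ℝ} (hx : x < aK K) :
    (x : ℂ) ∈ extDomain K := by
  refine ⟨fun h => ?_, fun ⟨t, ht, htx⟩ => ?_⟩
  · exact hx.not_ge (csInf_le (bddAbove_and_bddBelow_of_isBounded hK).2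
      (ofReal_mem_closure_of_mem_Kdoub h))
  · exact hx.not_ge (ofReal_injective htx ▸ ht.1)

namespace IsHullMap

variable {K : Set ℂ} {g : ℂ → ℂ} {S : Set ℝ}

lemma im_nonneg_of_mem_closure (h : IsHullMap K g S) {z : ℂ} (hz : z ∈ closure K) : 0 ≤ z.im :=
  closure_minimal (fun _ hy => le_of_lt (h.subset_UHP hy))
    (isClosed_le continuous_const continuous_im) hz

lemma notMem_Kdoub (h : IsHullMap K g S) {z : ℂ} (hz : z ∈ UHP \ K) : z ∉ Kdoub K := by
  have hz0 : 0 < z.im := hz.1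
  rintro (h' | ⟨y, hy, rfl⟩)
  · exact hz.2 (h.relClosed z h' hz0)
  · rw [conj_im] at hz0
    linarith [h.im_nonneg_of_mem_closure hy]

lemma mem_extDomain (h : IsHullMap K g S) {z : ℂ} (hz : z ∈ UHP \ K) : z ∈ extDomain K := by
  refine ⟨h.notMem_Kdoub hz, ?_⟩
  rintro ⟨t, _, rfl⟩
  simpa [UHP] using hz.1

lemma isBounded_Kdoub (h : IsHullMap K g S) : IsBounded (Kdoub K) :=
  h.bounded.closure.union
    ((h.bounded.isCompact_closure.image continuous_conj).isBounded)

lemma eventually_mem_extDomain (h : IsHullMap K g S) : ∀ᶠ z in cobounded ℂ, z ∈ extDomain K := by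
  filter_upwards [isBounded_def.1 h.isBounded_Kdoub, isBounded_def.1 (isCompact_seg K).isBounded]
    with z h1 h2 using ⟨h1, h2⟩

lemma differentiableOn_extDomain (h : IsHullMap K g S) (hne : K.Nonempty) :
    DifferentiableOn ℂ g (extDomain K) := (h.ext_holo hne).mono fun _ hz => hz.1

lemma bijOn_extDomain (h : IsHullMap K g S) (hne : K.Nonempty) :
    BijOn g (extDomain K) {z : ℂ | ∀ s ∈ S, z ≠ (s : ℂ)} := h.extBij hne

lemma hasDerivAt (h : IsHullMap K g S) (hne : K.Nonempty) {z : ℂ} (hz : z ∉ Kdoub K) :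
    HasDerivAt g (deriv g z) z :=
  ((h.ext_holo hne).differentiableAt ((isClosed_Kdoub K).isOpen_compl.mem_nhds hz)).hasDerivAt

lemma hasDerivAt_re (h : IsHullMap K g S) (hne : K.Nonempty) {x : ℝ} (hx : (x : ℂ) ∉ Kdoub K) :
    HasDerivAt (fun t : ℝ => (g t).re) (deriv g x).re x :=
  (h.hasDerivAt hne hx).real_of_complex

lemma ofReal_re_apply (h : IsHullMap K g S) (hne : K.Nonempty) {x : ℝ}
    (hx : (x : ℂ) ∉ Kdoub K) : (((g x).re : ℝ) : ℂ) = g x :=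
  Complex.ext rfl (h.real_vals hne x hx).symm

lemma im_pos (h : IsHullMap K g S) {z : ℂ} (hz : z ∉ Kdoub K) (hz0 : 0 < z.im) :
    0 < (g z).im :=
  h.bij.mapsTo ⟨hz0, fun hK => hz (Or.inl (subset_closure hK))⟩

lemma im_neg (h : IsHullMap K g S) (hne : K.Nonempty) {z : ℂ} (hz : z ∉ Kdoub K)
    (hz0 : z.im < 0) : (g z).im < 0 := by
  have := h.im_pos (z := starRingEnd ℂ z) (fun hz' => hz (conj_mem_Kdoub hz')) (by simpa using hz0)
  rw [h.conj_symm hne z hz, conj_im] at this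
  linarith

/-- The inverse of the Schwarz reflection of the mapping-out function. -/
def inv (_ : IsHullMap K g S) : ℂ → ℂ := Function.invFunOn g (extDomain K)

lemma inv_apply (h : IsHullMap K g S) (hne : K.Nonempty) {z : ℂ} (hz : z ∈ extDomain K) :
    h.inv (g z) = z := (h.bijOn_extDomain hne).injOn.leftInvOn_invFunOn hz

lemma inv_mem (h : IsHullMap K g S) (hne : K.Nonempty) {w : ℂ} (hw : ∀ s ∈ S, w ≠ (s : ℂ)) :
    h.inv w ∈ extDomain K := (h.bijOn_extDomain hne).surjOn.mapsTo_invFunOn hw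

lemma apply_inv (h : IsHullMap K g S) (hne : K.Nonempty) {w : ℂ} (hw : ∀ s ∈ S, w ≠ (s : ℂ)) :
    g (h.inv w) = w := (h.bijOn_extDomain hne).surjOn.rightInvOn_invFunOn hw

lemma differentiableOn_inv (h : IsHullMap K g S) (hne : K.Nonempty) :
    DifferentiableOn ℂ h.inv {z : ℂ | ∀ s ∈ S, z ≠ (s : ℂ)} := fun w hw => by
  have := differentiableAt_of_leftInvOn (isOpen_extDomain K) (h.differentiableOn_extDomain hne)
    (fun z hz => h.inv_apply hne hz) (h.inv_mem hne hw)
  rw [h.apply_inv hne hw] at this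
  exact this.differentiableWithinAt

lemma inv_conj (h : IsHullMap K g S) (hne : K.Nonempty) {w : ℂ} (hw : ∀ s ∈ S, w ≠ (s : ℂ)) :
    h.inv (starRingEnd ℂ w) = starRingEnd ℂ (h.inv w) := by
  have hm := h.inv_mem hne hw
  rw [← h.inv_apply hne (conj_mem_extDomain hm), h.conj_symm hne _ hm.1, h.apply_inv hne hw]

lemma inv_im_pos (h : IsHullMap K g S) (hne : K.Nonempty) {w : ℂ} (hw : 0 < w.im) :
    0 < (h.inv w).im := by
  obtain ⟨z, hz, rfl⟩ := h.bij.surjOn (show w ∈ UHP from hw)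
  rw [h.inv_apply hne (h.mem_extDomain hz)]
  exact hz.1

lemma tendsto_inv_cobounded (h : IsHullMap K g S) (hne : K.Nonempty) :
    Tendsto h.inv (cobounded ℂ) (cobounded ℂ) := by
  have hsm : ∀ᶠ z in cobounded ℂ, ‖g z - z‖ < 1 / 2 := by
    have := h.hydro.norm
    rw [norm_zero] at this
    exact this.eventually (gt_mem_nhds (by norm_num))
  obtain ⟨R, -, hR⟩ := hasBasis_cobounded_norm.eventually_iff.1 (hsm.and h.eventually_mem_extDomain)
  rw [← tendsto_norm_atTop_iff_cobounded]
  refine tendsto_atTop_mono' (f₁ := fun w => ‖w‖ - 4) _ ?_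
    (tendsto_atTop_add_const_right _ _ tendsto_norm_cobounded_atTop)
  refine hasBasis_cobounded_norm.eventually_iff.2 ⟨R + 4, trivial, fun w hw => ?_⟩
  have hw' : R + 4 ≤ ‖w‖ := hw
  have hfar : ∀ z ∈ closedBall w 4, ‖g z - z‖ < 1 / 2 ∧ z ∈ extDomain K := fun z hz => by
    refine hR (show R ≤ ‖z‖ from ?_)
    have h1 := norm_sub_norm_le w z
    rw [← dist_eq_norm, dist_comm] at h1
    linarith [mem_closedBall.1 hz]
  have hww := hfar w (mem_closedBall_self (by norm_num))
  have hsub : ball (g w) (3 / 2) ⊆ g '' closedBall w 4 := by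
    refine DiffContOnCl.ball_subset_image_closedBall ?_ (by norm_num) (fun z hz => ?_) ?_
    · refine DifferentiableOn.diffContOnCl ?_
      rw [closure_ball _ (by norm_num)]
      exact (h.differentiableOn_extDomain hne).mono fun z hz => (hfar z hz).2
    · have h1 := (hfar z (sphere_subset_closedBall hz)).1
      have h2 : ‖z - w‖ = 4 := by simpa [dist_eq_norm] using hz
      have h3 : ‖z - w‖ ≤ ‖g z - g w‖ + ‖g z - z‖ + ‖g w - w‖ := by
        calc ‖z - w‖ = ‖(g z - g w) - (g z - z) + (g w - w)‖ := by ring_nf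
          _ ≤ ‖(g z - g w) - (g z - z)‖ + ‖g w - w‖ := norm_add_le _ _
          _ ≤ _ := by gcongr; exact norm_sub_le _ _
      linarith [hww.1]
    · have hev : ∀ᶠ z in 𝓝[≠] w, g z ≠ g w := by
        rw [eventually_nhdsWithin_iff]
        filter_upwards [(isOpen_extDomain K).mem_nhds hww.2] with z hz hzw hgz
        exact hzw ((h.bijOn_extDomain hne).injOn hz hww.2 hgz)
      exact hev.frequently.filter_mono nhdsWithin_le_nhds
  obtain ⟨z, hz, hzw⟩ := hsub (show w ∈ ball (g w) (3 / 2) by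
    rw [mem_ball, dist_comm, dist_eq_norm]
    linarith [hww.1])
  have hinv : h.inv w = z := by
    rw [← h.inv_apply hne (hfar z hz).2, hzw]
  simp only [hinv]
  have h1 := norm_sub_norm_le w z
  rw [← dist_eq_norm, dist_comm] at h1
  linarith [mem_closedBall.1 hz]

lemma eventually_forall_ne (h : IsHullMap K g S) :
    ∀ᶠ w in cobounded ℂ, ∀ s ∈ S, w ≠ (s : ℂ) := by
  filter_upwards [isBounded_def.1 (h.compactS.image continuous_ofReal).isBounded] with w hw s hs hws
  exact hw ⟨s, hs, hws.symm⟩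

lemma tendsto_inv_sub (h : IsHullMap K g S) (hne : K.Nonempty) :
    Tendsto (fun w => h.inv w - w) (cobounded ℂ) (𝓝 0) := by
  have h1 := (h.hydro.comp (h.tendsto_inv_cobounded hne)).neg
  rw [neg_zero] at h1
  refine h1.congr' ?_
  filter_upwards [h.eventually_forall_ne] with w hw
  simp [h.apply_inv hne hw]

lemma exists_norm_inv_sub_le (h : IsHullMap K g S) (hne : K.Nonempty) :
    ∃ M : ℝ, ∀ w : ℂ, (∀ s ∈ S, w ≠ (s : ℂ)) → ‖h.inv w - w‖ ≤ M := by
  have hg := h.hydro.norm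
  have hf := (h.tendsto_inv_sub hne).norm
  rw [norm_zero] at hg hf
  obtain ⟨R, -, hR⟩ := hasBasis_cobounded_norm.eventually_iff.1
    (hg.eventually (gt_mem_nhds one_pos))
  obtain ⟨R', -, hR'⟩ := hasBasis_cobounded_norm.eventually_iff.1
    (hf.eventually (gt_mem_nhds one_pos))
  refine ⟨|R| + |R'| + 1, fun w hw => ?_⟩
  have := abs_nonneg R
  have := abs_nonneg R'
  by_cases h1 : R' ≤ ‖w‖
  · linarith [hR' h1]
  by_cases h2 : R ≤ ‖h.inv w‖
  · have h3 := hR h2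
    rw [h.apply_inv hne hw, norm_sub_rev] at h3
    linarith
  · linarith [norm_sub_le (h.inv w) w, le_abs_self R, le_abs_self R']

lemma inv_sub_im_nonneg (h : IsHullMap K g S) (hne : K.Nonempty) {w : ℂ} (hw : 0 < w.im) :
    0 ≤ (h.inv w - w).im := by
  refine im_nonneg_of_boundary (F := fun w => h.inv w - w)
    (((h.differentiableOn_inv hne).sub differentiableOn_id).mono fun z hz =>
      forall_ne_of_im_ne_zero (ne_of_gt hz)) (fun p ε hε => ?_) (fun ε hε => ?_) hw
  · have hp : ∀ᶠ z in 𝓝 (p : ℂ), z.im < ε :=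
      continuous_im.continuousAt.eventually (gt_mem_nhds (by simpa using hε))
    filter_upwards [hp] with z hz hz0
    rw [sub_im]
    linarith [h.inv_im_pos hne hz0]
  · have ht := (h.tendsto_inv_sub hne).norm
    rw [norm_zero] at ht
    filter_upwards [ht.eventually (gt_mem_nhds hε)] with z hz _
    linarith [abs_le.1 (abs_im_le_norm (h.inv z - z))]

lemma isBoundedPick (h : IsHullMap K g S) (hne : K.Nonempty) :
    IsBoundedPick (fun w => h.inv w - w) S where
  isCompact := h.compactS
  differentiableOn := (h.differentiableOn_inv hne).sub differentiableOn_id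
  real x hx := by
    have := h.inv_conj hne (ofReal_forall_ne hx)
    rw [conj_ofReal] at this
    rw [sub_im, ofReal_im, conj_eq_iff_im.1 this.symm, sub_zero]
  im_nonneg _ hw := h.inv_sub_im_nonneg hne hw
  im_nonpos w hw := by
    have := h.inv_sub_im_nonneg hne (w := starRingEnd ℂ w) (by simpa using hw)
    rw [h.inv_conj hne (forall_ne_of_im_ne_zero hw.ne), ← map_sub, conj_im] at this
    linarith
  bounded := h.exists_norm_inv_sub_le hne

/-! ### The derivative on the real line -/

lemma deriv_re_nonneg (h : IsHullMap K g S) (hne : K.Nonempty) {x : ℝ}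
    (hx : (x : ℂ) ∉ Kdoub K) : 0 ≤ (deriv g x).re := by
  refine (h.hasDerivAt hne hx).re_nonneg_of_im_nonneg (h.real_vals hne x hx) ?_
  filter_upwards [eventually_notMem_Kdoub hx] with w hw hw0 using (h.im_pos hw hw0).le

lemma deriv_re_le_one (h : IsHullMap K g S) (hne : K.Nonempty) {x : ℝ}
    (hx : (x : ℂ) ∉ Kdoub K) : (deriv g x).re ≤ 1 := by
  have := ((hasDerivAt_id (x : ℂ)).sub (h.hasDerivAt hne hx)).re_nonneg_of_im_nonneg
    (by simp [h.real_vals hne x hx]) (by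
      filter_upwards [eventually_notMem_Kdoub hx] with w hw hw0
      have h1 := h.inv_sub_im_nonneg hne (h.im_pos hw hw0)
      rwa [h.inv_apply hne
        (h.mem_extDomain ⟨hw0, fun hK => hw (Or.inl (subset_closure hK))⟩)] at h1)
  simpa using this

lemma deriv_im (h : IsHullMap K g S) (hne : K.Nonempty) {x : ℝ} (hx : (x : ℂ) ∉ Kdoub K) :
    (deriv g x).im = 0 := by
  refine (h.hasDerivAt hne hx).im_eq_zero_of_real ?_
  filter_upwards [continuous_ofReal.continuousAt.eventually (eventually_notMem_Kdoub hx)]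
    with t ht using h.real_vals hne t ht

lemma not_eventually_eq (h : IsHullMap K g S) (hne : K.Nonempty) {x : ℝ}
    (hx : (x : ℂ) ∉ Kdoub K) : ¬ ∀ᶠ z in 𝓝 (x : ℂ), g z = g x := by
  intro hev
  have hc : Tendsto (fun t : ℝ => (x : ℂ) + t * I) (𝓝[>] 0) (𝓝 (x : ℂ)) := by
    have : Continuous fun t : ℝ => (x : ℂ) + t * I := by fun_prop
    simpa using (this.tendsto 0).mono_left nhdsWithin_le_nhds
  obtain ⟨t, ⟨h1, h2⟩, ht⟩ := ((hc.eventually (hev.and (eventually_notMem_Kdoub hx))).and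
    self_mem_nhdsWithin).exists
  have h3 := h.im_pos h2 (by simpa using ht)
  rw [h1, h.real_vals hne x hx] at h3
  exact h3.false

lemma apply_ne_of_lt (h : IsHullMap K g S) (hne : K.Nonempty) {x y : ℝ} (hxy : x < y)
    (hK : ∀ t ∈ Icc x y, (t : ℂ) ∉ Kdoub K) : g x ≠ g y := by
  intro heq
  have hmono : MonotoneOn (fun t : ℝ => (g t).re) (Icc x y) := by
    refine monotoneOn_of_deriv_nonneg (convex_Icc x y)
      (fun t ht => (h.hasDerivAt_re hne (hK t ht)).continuousAt.continuousWithinAt)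
      (fun t ht => (h.hasDerivAt_re hne
        (hK t (interior_subset ht))).differentiableAt.differentiableWithinAt) (fun t ht => ?_)
    have ht' := hK t (interior_subset ht)
    rw [(h.hasDerivAt_re hne ht').deriv]
    exact h.deriv_re_nonneg hne ht'
  have hx := hK x (left_mem_Icc.2 hxy.le)
  have hconst : ∀ t ∈ Icc x y, g t = g x := fun t ht => by
    refine Complex.ext (le_antisymm ?_ (hmono (left_mem_Icc.2 hxy.le) ht ht.1)) ?_
    · rw [heq]
      exact hmono ht (right_mem_Icc.2 hxy.le) ht.2
    · rw [h.real_vals hne t (hK t ht), h.real_vals hne x hx]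
  refine h.not_eventually_eq hne hx ?_
  have hana : AnalyticAt ℂ g x :=
    (h.ext_holo hne).analyticAt ((isClosed_Kdoub K).isOpen_compl.mem_nhds hx)
  refine (hana.frequently_eq_iff_eventually_eq analyticAt_const).1 ?_
  have htend : Tendsto (fun t : ℝ => (t : ℂ)) (𝓝[>] x) (𝓝[≠] (x : ℂ)) := by
    refine tendsto_nhdsWithin_iff.2
      ⟨(continuous_ofReal.tendsto x).mono_left nhdsWithin_le_nhds, ?_⟩
    filter_upwards [self_mem_nhdsWithin] with t ht
    have ht' : x < t := ht
    simpa using ht'.ne'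
  refine htend.frequently (Eventually.frequently ?_)
  filter_upwards [Ioc_mem_nhdsGT hxy] with t ht using hconst t ⟨ht.1.le, ht.2⟩

lemma deriv_ne_zero (h : IsHullMap K g S) (hne : K.Nonempty) {x : ℝ} (hx : (x : ℂ) ∉ Kdoub K) :
    deriv g x ≠ 0 := by
  obtain ⟨r, hr, hball⟩ := Metric.eventually_nhds_iff_ball.1 (eventually_notMem_Kdoub hx)
  refine deriv_ne_zero_of_injOn isOpen_ball ((h.ext_holo hne).mono hball) ?_ (mem_ball_self hr)
  have hreal : ∀ s t : ℝ, (s : ℂ) ∈ ball (x : ℂ) r → (t : ℂ) ∈ ball (x : ℂ) r → s < t →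
      g s ≠ g t := fun s t hs ht hst => by
    refine h.apply_ne_of_lt hne hst fun u hu => hball _ ?_
    rw [mem_ball, dist_eq_norm, ← ofReal_sub, norm_real, Real.norm_eq_abs, abs_lt] at hs ht ⊢
    constructor <;> linarith [hu.1, hu.2]
  intro z hz w hw hzw
  have him := congrArg Complex.im hzw
  have hzK := hball z hz
  have hwK := hball w hw
  have hzero : ∀ y : ℂ, y ∉ Kdoub K → y.im = 0 → (g y).im = 0 := fun y hy hy0 => by
    have hye : y = (y.re : ℂ) := Complex.ext (by simp) (by simp [hy0])
    rw [hye] at hy ⊢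
    exact h.real_vals hne _ hy
  rcases lt_trichotomy z.im 0 with h1 | h1 | h1 <;> rcases lt_trichotomy w.im 0 with h2 | h2 | h2
  · have hinj := (h.bijOn_extDomain hne).injOn
    refine hinj ⟨hzK, ?_⟩ ⟨hwK, ?_⟩ hzw <;>
    · rintro ⟨t, -, rfl⟩
      simp at h1 h2
  · linarith [h.im_neg hne hzK h1, hzero w hwK h2]
  · linarith [h.im_neg hne hzK h1, h.im_pos hwK h2]
  · linarith [h.im_neg hne hwK h2, hzero z hzK h1]
  · have hze : z = (z.re : ℂ) := Complex.ext (by simp) (by simp [h1])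
    have hwe : w = (w.re : ℂ) := Complex.ext (by simp) (by simp [h2])
    rw [hze] at hz hzw ⊢
    rw [hwe] at hw hzw ⊢
    rcases lt_trichotomy z.re w.re with h3 | h3 | h3
    · exact absurd hzw (hreal _ _ hz hw h3)
    · rw [h3]
    · exact absurd hzw.symm (hreal _ _ hw hz h3)
  · linarith [h.im_pos hwK h2, hzero z hzK h1]
  · linarith [h.im_neg hne hwK h2, h.im_pos hzK h1]
  · linarith [h.im_pos hzK h1, hzero w hwK h2]
  · exact (h.bijOn_extDomain hne).injOn
      (h.mem_extDomain ⟨h1, fun hK => hzK (Or.inl (subset_closure hK))⟩)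
      (h.mem_extDomain ⟨h2, fun hK => hwK (Or.inl (subset_closure hK))⟩) hzw

lemma deriv_re_pos (h : IsHullMap K g S) (hne : K.Nonempty) {x : ℝ} (hx : (x : ℂ) ∉ Kdoub K) :
    0 < (deriv g x).re := by
  refine (h.deriv_re_nonneg hne hx).lt_of_ne' fun h0 => h.deriv_ne_zero hne hx ?_
  exact Complex.ext h0 (h.deriv_im hne hx)

lemma deriv_inv_sub_re (h : IsHullMap K g S) (hne : K.Nonempty) {x : ℝ}
    (hx : (x : ℂ) ∈ extDomain K) :
    (deriv (fun w => h.inv w - w) ((g x).re : ℂ)).re = (deriv g x).re⁻¹ - 1 := by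
  have h1 := (hasDerivAt_of_leftInvOn (isOpen_extDomain K) (h.differentiableOn_extDomain hne)
    (fun z hz => h.inv_apply hne hz) hx (h.deriv_ne_zero hne hx.1)).sub (hasDerivAt_id (g x))
  have h2 : deriv g x = ((deriv g x).re : ℂ) := Complex.ext (by simp) (by simp [h.deriv_im hne hx.1])
  rw [h.ofReal_re_apply hne hx.1]
  refine (congrArg Complex.re h1.deriv).trans ?_
  rw [h2, ← ofReal_inv]
  simp

lemma strictMonoOn_re (h : IsHullMap K g S) (hne : K.Nonempty) {A : Set ℝ} (hA : Convex ℝ A)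
    (hAK : ∀ t ∈ A, (t : ℂ) ∉ Kdoub K) : StrictMonoOn (fun t : ℝ => (g t).re) A := by
  refine strictMonoOn_of_deriv_pos hA
    (fun t ht => (h.hasDerivAt_re hne (hAK t ht)).continuousAt.continuousWithinAt) fun t ht => ?_
  have ht' := hAK t (interior_subset ht)
  rw [(h.hasDerivAt_re hne ht').deriv]
  exact h.deriv_re_pos hne ht'

lemma notMem_of_mem_extDomain (h : IsHullMap K g S) (hne : K.Nonempty) {x : ℝ}
    (hx : (x : ℂ) ∈ extDomain K) : (g x).re ∉ S := fun hs =>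
  (h.bijOn_extDomain hne).mapsTo hx _ hs (h.ofReal_re_apply hne hx.1).symm

lemma tendsto_re_sub (h : IsHullMap K g S) {l : Filter ℝ}
    (hl : Tendsto (fun t : ℝ => (t : ℂ)) l (cobounded ℂ)) :
    Tendsto (fun t : ℝ => (g t).re - t) l (𝓝 0) := by
  simpa [Function.comp_def] using (continuous_re.tendsto 0).comp (h.hydro.comp hl)

lemma lt_re_of_gt (h : IsHullMap K g S) (hne : K.Nonempty) {x : ℝ} (hx : bK K < x) :
    ∀ s ∈ S, s < (g x).re := by
  intro s hs
  by_contra! hle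
  have hcob : Tendsto (fun t : ℝ => (t : ℂ)) atTop (cobounded ℂ) := by
    rw [← tendsto_norm_atTop_iff_cobounded]
    simpa using tendsto_abs_atTop_atTop
  obtain ⟨y, ⟨hy1, hy2⟩, hy3⟩ := (((h.tendsto_re_sub hcob).eventually
    (lt_mem_nhds (show (-1 : ℝ) < 0 by norm_num))).and (eventually_ge_atTop (s + 1))).and
      (eventually_ge_atTop x) |>.exists
  obtain ⟨t, ht, hts⟩ := intermediate_value_Icc (f := fun t : ℝ => (g t).re) hy3
    (fun t ht => (h.hasDerivAt_re hne
      (ofReal_mem_extDomain_of_gt h.bounded (hx.trans_le ht.1)).1).continuousAt.continuousWithinAt)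
    (show s ∈ Icc _ _ from ⟨hle, by linarith⟩)
  exact h.notMem_of_mem_extDomain hne
    (ofReal_mem_extDomain_of_gt h.bounded (hx.trans_le ht.1))
    (mem_of_eq_of_mem hts hs)

lemma re_lt_of_lt (h : IsHullMap K g S) (hne : K.Nonempty) {x : ℝ} (hx : x < aK K) :
    ∀ s ∈ S, (g x).re < s := by
  intro s hs
  by_contra! hle
  have hcob : Tendsto (fun t : ℝ => (t : ℂ)) atBot (cobounded ℂ) := by
    rw [← tendsto_norm_atTop_iff_cobounded]
    simpa using tendsto_abs_atBot_atTop
  obtain ⟨y, ⟨hy1, hy2⟩, hy3⟩ := (((h.tendsto_re_sub hcob).eventually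
    (gt_mem_nhds (show (0 : ℝ) < 1 by norm_num))).and (eventually_le_atBot (s - 1))).and
      (eventually_le_atBot x) |>.exists
  obtain ⟨t, ht, hts⟩ := intermediate_value_Icc (f := fun t : ℝ => (g t).re) hy3
    (fun t ht => (h.hasDerivAt_re hne
      (ofReal_mem_extDomain_of_lt h.bounded (ht.2.trans_lt hx)).1).continuousAt.continuousWithinAt)
    (show s ∈ Icc _ _ from ⟨by linarith, hle⟩)
  exact h.notMem_of_mem_extDomain hne
    (ofReal_mem_extDomain_of_lt h.bounded (ht.2.trans_lt hx))
    (mem_of_eq_of_mem hts hs)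

end IsHullMap

/-- **Monotonicity of `g_K'` on the real line.** For a nonempty `ℍ`-hull `K`,
`0 < g_K'(x) ≤ 1` for every real `x ∉ K^doub`; moreover `g_K'` is decreasing on
`(-∞, a_K)` and increasing on `(b_K, ∞)`. -/
theorem stmt_2 (K : Set ℂ) (g : ℂ → ℂ) (S : Set ℝ)
    (h : IsHullMap K g S) (hne : K.Nonempty) :
    (∀ x : ℝ, (x : ℂ) ∉ Kdoub K →
      0 < deriv (fun t : ℝ => (g (t : ℂ)).re) x ∧ deriv (fun t : ℝ => (g (t : ℂ)).re) x ≤ 1)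
    ∧ AntitoneOn (fun x : ℝ => deriv (fun t : ℝ => (g (t : ℂ)).re) x) (Set.Iio (aK K))
    ∧ MonotoneOn (fun x : ℝ => deriv (fun t : ℝ => (g (t : ℂ)).re) x) (Set.Ioi (bK K)) := by
  refine ⟨fun x hx => ?_, fun x hx y hy hxy => ?_, fun x hx y hy hxy => ?_⟩
  · rw [(h.hasDerivAt_re hne hx).deriv]
    exact ⟨h.deriv_re_pos hne hx, h.deriv_re_le_one hne hx⟩
  · have hD : ∀ t ∈ Iio (aK K), (t : ℂ) ∈ extDomain K :=
      fun t ht => ofReal_mem_extDomain_of_lt h.bounded ht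
    have hgxy := (h.strictMonoOn_re hne (convex_Iio _) fun t ht => (hD t ht).1).monotoneOn hx hy hxy
    have key := (h.isBoundedPick hne).deriv_monotone_left (h.re_lt_of_lt hne hy) hgxy
    rw [h.deriv_inv_sub_re hne (hD x hx), h.deriv_inv_sub_re hne (hD y hy),
      sub_le_sub_iff_right, inv_le_inv₀ (h.deriv_re_pos hne (hD x hx).1)
        (h.deriv_re_pos hne (hD y hy).1)] at key
    simpa only [(h.hasDerivAt_re hne (hD x hx).1).deriv, (h.hasDerivAt_re hne (hD y hy).1).deriv]
  · have hD : ∀ t ∈ Ioi (bK K), (t : ℂ) ∈ extDomain K :=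
      fun t ht => ofReal_mem_extDomain_of_gt h.bounded ht
    have hgxy := (h.strictMonoOn_re hne (convex_Ioi _) fun t ht => (hD t ht).1).monotoneOn hx hy hxy
    have key := (h.isBoundedPick hne).deriv_antitone_right (h.lt_re_of_gt hne hx) hgxy
    rw [h.deriv_inv_sub_re hne (hD x hx), h.deriv_inv_sub_re hne (hD y hy),
      sub_le_sub_iff_right, inv_le_inv₀ (h.deriv_re_pos hne (hD y hy).1)
        (h.deriv_re_pos hne (hD x hx).1)] at key
    simpa only [(h.hasDerivAt_re hne (hD x hx).1).deriv, (h.hasDerivAt_re hne (hD y hy).1).deriv]
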